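/- arXiv:math/0408158 — 2 statements merged into one kernel-verified Lean document; each statement's English description precedes it below -/
import Mathlib

section
/- Let n ≥ 1, let W : ℝ^n → ℝ^n be a C^∞ diffeomorphism that is a lift of a map V : T^n → T^n, and let B ∈ M(n,ℤ) satisfy W(x + m) − W(x) = Bm for all x ∈ ℝ^n and m ∈ ℤ^n. Then V is a bijection of T^n (so that W is a lift of a diffeomorphism of T^n) if and only if det B = ±1, i.e. B ∈ GL(n,ℤ). -/
noncomputable section

/-- Euclidean space `ℝ^n`. -/
abbrev Eucl (n : ℕ) := Fin n → ℝ

/-- The inclusion of the integer lattice `ℤ^n` into `ℝ^n`. -/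
def intVec {n : ℕ} (m : Fin n → ℤ) : Eucl n := fun i => (m i : ℝ)

/-- The integer lattice `ℤ^n` as an additive subgroup of `ℝ^n`. -/
def intLattice (n : ℕ) : AddSubgroup (Eucl n) where
  carrier := Set.range (intVec (n := n))
  add_mem' := by
    rintro _ _ ⟨p, rfl⟩ ⟨q, rfl⟩
    exact ⟨p + q, by funext i; simp [intVec]⟩
  zero_mem' := ⟨0, by funext i; simp [intVec]⟩
  neg_mem' := by
    rintro _ ⟨p, rfl⟩
    exact ⟨-p, by funext i; simp [intVec]⟩

/-- The `n`-torus `T^n = ℝ^n / ℤ^n`. -/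
abbrev Torus (n : ℕ) := Eucl n ⧸ intLattice n

/-- The covering projection `π : ℝ^n → T^n`. -/
def torusPi (n : ℕ) : Eucl n → Torus n := QuotientAddGroup.mk

/-- `W : ℝ^n → ℝ^n` is a lift of `V : T^n → T^n`, i.e. `V ∘ π = π ∘ W`. -/
def IsLift {n : ℕ} (V : Torus n → Torus n) (W : Eucl n → Eucl n) : Prop :=
  ∀ x, V (torusPi n x) = torusPi n (W x)

/-- An integer matrix viewed as a real matrix. -/
def matR {n : ℕ} (B : Matrix (Fin n) (Fin n) ℤ) : Matrix (Fin n) (Fin n) ℝ :=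
  B.map Int.cast

/-- `W` is a `C^∞` diffeomorphism of `ℝ^n`. -/
def SmoothDiffeoR {n : ℕ} (W : Eucl n → Eucl n) : Prop :=
  ContDiff ℝ (⊤ : ℕ∞) W ∧ ∃ W' : Eucl n → Eucl n, ContDiff ℝ (⊤ : ℕ∞) W' ∧
    Function.LeftInverse W' W ∧ Function.RightInverse W' W

/-- The components of `a ∈ ℝ^n` are linearly independent over `ℚ`. -/
def QIndep {n : ℕ} (a : Eucl n) : Prop := LinearIndependent ℚ a

/-- `R` is a generalized symmetry, with multiplier `α`, of the flow on `T^n` generated by the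
constant vector field `a`: `R` is a diffeomorphism of the torus (a bijection admitting a smooth
diffeomorphism lift) and a lift `R̂` satisfies `(DR̂(x))a = αa` for all `x`. -/
def IsGenSym {n : ℕ} (a : Eucl n) (α : ℝ) (R : Torus n → Torus n) : Prop :=
  Function.Bijective R ∧ ∃ Rh : Eucl n → Eucl n, IsLift R Rh ∧ SmoothDiffeoR Rh ∧
    ∀ x, fderiv ℝ Rh x a = α • a

/-- The multiplier group `M_a ⊆ ℝ \ {0}` of the flow generated by the constant vector field `a`. -/
def Mgroup {n : ℕ} (a : Eucl n) : Set ℝ :=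
  {α | α ≠ 0 ∧ ∃ R : Torus n → Torus n, IsGenSym a α R}

/-- The flow generated by the constant vector field `a` is smoothly semiconjugate to the flow
generated by the constant vector field `b` by the surjective map `V : T^n → T^n`: `V` admits a
`C^∞` lift `W` with `(DW(x))a = b` for all `x`. -/
def SmoothSemiconj {n : ℕ} (a b : Eucl n) (V : Torus n → Torus n) : Prop :=
  Function.Surjective V ∧ ∃ W : Eucl n → Eucl n, IsLift V W ∧ ContDiff ℝ (⊤ : ℕ∞) W ∧
    ∀ x, fderiv ℝ W x a = b

/-- The numbers `ϑ * a 1, …, ϑ * a n` all lie in the subfield `F` of `ℝ` and form a basis of `F`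
as a vector space over `ℚ`. -/
def IsAlgebraicFreq {n : ℕ} (a : Eucl n) (ϑ : ℝ) (F : Subfield ℝ) : Prop :=
  (∀ i, ϑ * a i ∈ F) ∧ LinearIndependent ℚ (fun i => ϑ * a i) ∧
    ∀ y ∈ F, ∃ q : Fin n → ℚ, y = ∑ i, (q i : ℝ) * (ϑ * a i)

theorem mulVec_matR_intVec {n : ℕ} (B : Matrix (Fin n) (Fin n) ℤ) (m : Fin n → ℤ) :
    (matR B).mulVec (intVec m) = intVec (B.mulVec m) := by
  funext i
  simp [matR, intVec, Matrix.mulVec, dotProduct]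

theorem intVec_injective {n : ℕ} : Function.Injective (intVec (n := n)) := fun p q h => by
  funext i
  exact Int.cast_injective (congrFun h i)

theorem torusPi_eq_iff {n : ℕ} {x y : Eucl n} :
    torusPi n x = torusPi n y ↔ ∃ m : Fin n → ℤ, y = x + intVec m := by
  unfold torusPi
  rw [QuotientAddGroup.eq]
  constructor
  · rintro ⟨m, hm⟩
    exact ⟨m, by rw [hm]; abel⟩
  · rintro ⟨m, rfl⟩
    exact ⟨m, by abel⟩

/-- If `W` is a `C^∞` diffeomorphism of `ℝ^n` lifting `V : T^n → T^n`, with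
`W (x + m) - W x = B m` for an integer matrix `B`, then `V` is a bijection of the torus if and
only if `det B = ±1`. -/
theorem stmt_1 (n : ℕ) (hn : 1 ≤ n) (W : Eucl n → Eucl n) (hW : SmoothDiffeoR W)
    (V : Torus n → Torus n) (hlift : IsLift V W)
    (B : Matrix (Fin n) (Fin n) ℤ)
    (hB : ∀ (x : Eucl n) (m : Fin n → ℤ),
      W (x + intVec m) - W x = (matR B).mulVec (intVec m)) :
    Function.Bijective V ↔ (B.det = 1 ∨ B.det = -1) := by
  obtain ⟨-, W', -, hl, hr⟩ := hW
  have hB' (x : Eucl n) (m : Fin n → ℤ) : W (x + intVec m) = W x + intVec (B.mulVec m) := by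
    rw [← mulVec_matR_intVec, ← hB x m, add_sub_cancel]
  rw [← Int.isUnit_iff, ← Matrix.isUnit_iff_isUnit_det, ← Matrix.mulVec_surjective_iff_isUnit]
  constructor
  · intro hV k
    obtain ⟨x, hx⟩ := hr.surjective (W 0 + intVec k)
    have h : torusPi n 0 = torusPi n x := hV.injective <| by
      rw [hlift, hlift]
      exact torusPi_eq_iff.2 ⟨k, hx⟩
    obtain ⟨m, rfl⟩ := torusPi_eq_iff.1 h
    rw [hB'] at hx
    exact ⟨m, intVec_injective (add_left_cancel hx)⟩
  · intro hsurj
    refine ⟨fun p q h => ?_, fun q => ?_⟩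
    · obtain ⟨x, rfl⟩ := QuotientAddGroup.mk_surjective p
      obtain ⟨y, rfl⟩ := QuotientAddGroup.mk_surjective q
      change V (torusPi n x) = V (torusPi n y) at h
      rw [hlift, hlift] at h
      obtain ⟨k, hk⟩ := torusPi_eq_iff.1 h
      obtain ⟨m, rfl⟩ := hsurj k
      rw [← hB'] at hk
      exact torusPi_eq_iff.2 ⟨m, hl.injective hk⟩
    · obtain ⟨y, rfl⟩ := QuotientAddGroup.mk_surjective q
      exact ⟨torusPi n (W' y), by rw [hlift, hr y]; rfl⟩
end
end

section
/- Let n ≥ 1, let a, d ∈ ℝ^n with the components a_1,…,a_n of a linearly independent over ℚ, let B ∈ M(n,ℤ), and let f : ℝ^n → ℝ^n be a C^∞ map such that f(x + m) − f(x) = Bm for all x ∈ ℝ^n and m ∈ ℤ^n, and such that the total derivative of f at every point x satisfies (Df(x))a = d. Then f is affine: there exists c ∈ ℝ^n such that f(x) = Bx + c for all x ∈ ℝ^n. -/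
noncomputable section

namespace UnitAddTorus

open MeasureTheory

variable {ι : Type*}

/-- The canonical projection `ℝ^ι → (ℝ/ℤ)^ι`. -/
def proj (x : ι → ℝ) : UnitAddTorus ι := fun i => (x i : UnitAddCircle)

lemma proj_add (x y : ι → ℝ) : proj (x + y) = proj x + proj y := rfl

lemma isOpenQuotientMap_proj : IsOpenQuotientMap (proj (ι := ι)) :=
  IsOpenQuotientMap.piMap fun _ => QuotientAddGroup.isOpenQuotientMap_mk

lemma proj_eq_iff {x y : ι → ℝ} :
    proj x = proj y ↔ ∃ m : ι → ℤ, y = x + fun i => (m i : ℝ) := by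
  refine ⟨fun h => ?_, ?_⟩
  · have key : ∀ i, ∃ m : ℤ, y i = x i + m := fun i => by
      obtain ⟨m, hm⟩ := QuotientAddGroup.eq.1 (congrFun h i)
      exact ⟨m, by simp at hm; linarith⟩
    choose m hm using key
    exact ⟨m, funext hm⟩
  · rintro ⟨m, rfl⟩
    funext i
    simp [proj]

/-- A continuous `ℤ^ι`-periodic function on `ℝ^ι` descends to the torus. -/
lemma exists_continuousMap_comp_proj {E : Type*} [TopologicalSpace E] {g : (ι → ℝ) → E}
    (hg : Continuous g) (hper : ∀ x (m : ι → ℤ), g (x + fun i => (m i : ℝ)) = g x) :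
    ∃ G : C(UnitAddTorus ι, E), ∀ x, G (proj x) = g x := by
  have hq := isOpenQuotientMap_proj (ι := ι)
  have hcomp : ∀ x, g (Function.surjInv hq.surjective (proj x)) = g x := fun x => by
    obtain ⟨m, hm⟩ := proj_eq_iff.1 (Function.surjInv_eq hq.surjective (proj x))
    conv_rhs => rw [hm, hper]
  refine ⟨⟨fun y => g (Function.surjInv hq.surjective y), ?_⟩, hcomp⟩
  rw [hq.isQuotientMap.continuous_iff]
  exact hg.congr fun x => (hcomp x).symm

variable [Fintype ι]

lemma mFourier_apply_add (n : ι → ℤ) (x y : UnitAddTorus ι) :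
    mFourier n (x + y) = mFourier n x * mFourier n y := by
  simp [mFourier, fourier_apply, smul_add, AddCircle.toCircle_add, Finset.prod_mul_distrib]

lemma mFourier_proj (n : ι → ℤ) (x : ι → ℝ) :
    mFourier n (proj x) = Complex.exp (2 * Real.pi * Complex.I * (∑ i, n i * x i : ℝ)) := by
  simp [mFourier, proj, Finset.mul_sum, Complex.exp_sum, mul_assoc]

lemma mFourierCoeff_comp_add_right (G : UnitAddTorus ι → ℂ) (s : UnitAddTorus ι) (n : ι → ℤ) :
    mFourier (-n) s * mFourierCoeff (fun x => G (x + s)) n = mFourierCoeff G n := by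
  have hdef (F : UnitAddTorus ι → ℂ) : mFourierCoeff F n =
      ∫ t, mFourier (-n) t * F t ∂Measure.pi fun _ => AddCircle.haarAddCircle := rfl
  rw [hdef, hdef, ← integral_add_right_eq_self (fun t => mFourier (-n) t * G t) s, ← integral_const_mul]
  congr 1 with t
  rw [mFourier_apply_add]
  ring

/-- A linear flow with rationally independent frequencies only preserves constant functions. -/
theorem eq_of_forall_add_proj_smul {a : ι → ℝ} (ha : LinearIndependent ℚ a)
    (G : C(UnitAddTorus ι, ℂ)) (hG : ∀ (t : ℝ) x, G (x + proj (t • a)) = G x)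
    (x y : UnitAddTorus ι) : G x = G y := by
  have hcoeff : ∀ n ≠ 0, mFourierCoeff G n = 0 := by
    intro n hn
    have hna : ∑ i, (n i : ℝ) * a i ≠ 0 := fun h => hn <| by
      have := Fintype.linearIndependent_iff.1 ha (fun i => (n i : ℚ))
        (by simpa [Rat.smul_def] using h)
      funext i
      exact_mod_cast this i
    set σ := ∑ i, (n i : ℝ) * a i
    have hshift := mFourierCoeff_comp_add_right G (proj ((2 * σ)⁻¹ • a)) n
    simp only [hG] at hshift
    have hval : mFourier (-n) (proj ((2 * σ)⁻¹ • a)) = -1 := by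
      have hsum : ∑ i, ((-n) i : ℝ) * ((2 * σ)⁻¹ • a) i = -(1 / 2) := by
        calc _ = ∑ i, -(2 * σ)⁻¹ * ((n i : ℝ) * a i) := by
              refine Finset.sum_congr rfl fun i _ => ?_
              simp only [Pi.neg_apply, Int.cast_neg, Pi.smul_apply, smul_eq_mul]
              ring
          _ = -(2 * σ)⁻¹ * σ := by rw [← Finset.mul_sum]
          _ = _ := by field_simp
      rw [mFourier_proj, hsum, show 2 * (Real.pi : ℂ) * Complex.I * (-(1 / 2) : ℝ) =
        -(Real.pi * Complex.I) by push_cast; ring, Complex.exp_neg, Complex.exp_pi_mul_I]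
      norm_num
    rw [hval] at hshift
    linear_combination (-1 / 2 : ℂ) * hshift
  have hsummable : Summable (mFourierCoeff G) :=
    summable_of_ne_finset_zero (s := {0}) fun n hn => hcoeff n (by simpa using hn)
  have hconst (z : UnitAddTorus ι) : G z = mFourierCoeff G 0 := by
    have h := hasSum_mFourier_series_apply_of_summable hsummable z
    have h' := hasSum_single (f := fun i => mFourierCoeff G i • mFourier i z) 0
      fun n hn => by simp [hcoeff n hn]
    simpa [mFourier_zero] using h.unique h'
  rw [hconst, hconst]

end UnitAddTorus

/-- A continuous periodic function which grows linearly along a linear flow with rationally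
independent frequencies is constant. -/
lemma eq_of_periodic_of_add_smul {ι : Type*} [Fintype ι] {a : ι → ℝ}
    (ha : LinearIndependent ℚ a) {g : (ι → ℝ) → ℝ} (hg : Continuous g)
    (hper : ∀ x (m : ι → ℤ), g (x + fun i => (m i : ℝ)) = g x) {e : ℝ}
    (hflow : ∀ x (t : ℝ), g (x + t • a) = g x + t * e) (x y : ι → ℝ) : g x = g y := by
  obtain ⟨G, hG⟩ := UnitAddTorus.exists_continuousMap_comp_proj (g := fun x => (g x : ℂ))
    (by fun_prop) (fun x m => by rw [hper])
  have hbdd (z : ι → ℝ) : |g z| ≤ ‖G‖ := by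
    simpa [hG] using G.norm_coe_le_norm (UnitAddTorus.proj z)
  have he : e = 0 := by
    by_contra he
    have h := hflow 0 ((2 * ‖G‖ + 1) / e)
    rw [div_mul_cancel₀ _ he] at h
    have h₁ := abs_le.1 (hbdd 0)
    have h₂ := abs_le.1 (hbdd (0 + ((2 * ‖G‖ + 1) / e) • a))
    linarith
  have hinv (t : ℝ) (z) : G (z + UnitAddTorus.proj (t • a)) = G z := by
    obtain ⟨z, rfl⟩ := UnitAddTorus.isOpenQuotientMap_proj.surjective z
    rw [← UnitAddTorus.proj_add, hG, hG, hflow, he, mul_zero, add_zero]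
  have h := UnitAddTorus.eq_of_forall_add_proj_smul ha G hinv
    (UnitAddTorus.proj x) (UnitAddTorus.proj y)
  rw [hG, hG] at h
  exact_mod_cast h

/-- A function with constant derivative in the direction `a` is affine along lines parallel
to `a`. -/
lemma apply_add_smul_of_fderiv_eq {E F : Type*} [NormedAddCommGroup E] [NormedSpace ℝ E]
    [NormedAddCommGroup F] [NormedSpace ℝ F] {f : E → F} (hf : Differentiable ℝ f) {a : E} {d : F}
    (hder : ∀ x, fderiv ℝ f x a = d) (x : E) (t : ℝ) : f (x + t • a) = f x + t • d := by
  have hline (s : ℝ) : HasDerivAt (fun s : ℝ => f (x + s • a) - s • d) 0 s := by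
    have h₁ : HasDerivAt (fun s : ℝ => x + s • a) a s := by
      simpa using ((hasDerivAt_id s).smul_const a).const_add x
    have h₂ := (hf (x + s • a)).hasFDerivAt.comp_hasDerivAt s h₁
    rw [hder] at h₂
    have h₃ := h₂.sub ((hasDerivAt_id s).smul_const d)
    rwa [one_smul, sub_self] at h₃
  have h := is_const_of_deriv_eq_zero (fun s => (hline s).differentiableAt)
    (fun s => (hline s).deriv) t 0
  simp only [zero_smul, add_zero, sub_zero] at h
  rw [← h, sub_add_cancel]

/-- a smooth lift (cocycle matrix `B`) with `(Df(x))a = d` for a `ℚ`-independent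
frequency vector `a` is affine: `f x = B x + c`. -/
theorem stmt_3 (n : ℕ) (hn : 1 ≤ n) (a d : Eucl n) (ha : QIndep a)
    (B : Matrix (Fin n) (Fin n) ℤ) (f : Eucl n → Eucl n) (hf : ContDiff ℝ (⊤ : ℕ∞) f)
    (hcocycle : ∀ (x : Eucl n) (m : Fin n → ℤ),
      f (x + intVec m) - f x = (matR B).mulVec (intVec m))
    (hder : ∀ x : Eucl n, fderiv ℝ f x a = d) :
    ∃ c : Eucl n, ∀ x : Eucl n, f x = (matR B).mulVec x + c := by
  refine ⟨f 0, fun x => ?_⟩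
  funext i
  have hline := apply_add_smul_of_fderiv_eq (hf.differentiable (by simp)) hder
  have hconst := eq_of_periodic_of_add_smul ha (g := fun x => f x i - (matR B).mulVec x i)
    (e := d i - (matR B).mulVec a i) ?_ ?_ ?_ x 0
  · simp only [Matrix.mulVec_zero, Pi.zero_apply, sub_zero] at hconst
    rw [Pi.add_apply, ← hconst]
    ring
  · have hf' := hf.continuous
    exact (continuous_apply i |>.comp hf').sub
      (continuous_apply i |>.comp (continuous_const.matrix_mulVec continuous_id))
  · intro x m
    have h := congrFun (hcocycle x m) i
    simp only [Pi.sub_apply] at h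
    change f (x + intVec m) i - (matR B).mulVec (x + intVec m) i = _
    rw [Matrix.mulVec_add, Pi.add_apply]
    linarith
  · intro x t
    simp only [hline, Matrix.mulVec_add, Matrix.mulVec_smul, Pi.add_apply, Pi.smul_apply,
      smul_eq_mul]
    ring
end
end
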